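/- arXiv:2409.17347 — 10 statements merged into one kernel-verified Lean document; each statement's English description precedes it below -/
import Mathlib

section
/- Let N ≥ 1 and let M be an N×N real matrix with Tr(M) = 0 which has a nonzero kernel (equivalently, det M = 0). For k ≥ 1 set s_k := Tr(M^k) (so s_1 = 0). Define the N×N real matrix H₀ by: H₀ i (i+1) = i for 1 ≤ i ≤ N−1, H₀ i j = s_{i−j+1} for j ≤ i (so all diagonal entries are s_1 = 0), and H₀ i j = 0 for j > i+1. Then det(H₀) = 0. -/
open Polynomial in
/-- **Jacobi's formula**, column form: the derivative of the determinant of a matrix of polynomials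
is the sum of the determinants obtained by differentiating one column. -/
theorem Matrix.derivative_det {n R : Type*} [Fintype n] [DecidableEq n] [CommRing R]
    (A : Matrix n n R[X]) :
    derivative A.det = ∑ i, (A.updateCol i fun k => derivative (A k i)).det := by
  simp only [Matrix.det_apply, derivative_sum, derivative_smul, derivative_prod_finset,
    Units.smul_def]
  rw [Finset.sum_comm]
  refine Finset.sum_congr rfl fun σ _ => ?_
  rw [← Finset.smul_sum]
  congr 1
  refine Finset.sum_congr rfl fun i _ => ?_
  rw [← Finset.mul_prod_erase _ _ (Finset.mem_univ i), Matrix.updateCol_self, mul_comm]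
  congr 1
  refine Finset.prod_congr rfl fun k hk => ?_
  rw [Matrix.updateCol_ne (Finset.ne_of_mem_erase hk)]

/-- The derivative of the characteristic polynomial is the trace of the adjugate of the
characteristic matrix. -/
theorem Matrix.derivative_charpoly {n R : Type*} [Fintype n] [DecidableEq n] [CommRing R]
    (M : Matrix n n R) :
    Polynomial.derivative M.charpoly = M.charmatrix.adjugate.trace := by
  rw [Matrix.charpoly, Matrix.derivative_det, Matrix.trace]
  refine Finset.sum_congr rfl fun i _ => ?_
  rw [Matrix.diag_apply, ← Matrix.transpose_apply M.charmatrix.adjugate i i,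
    Matrix.adjugate_transpose, Matrix.adjugate_apply, Matrix.updateRow_transpose,
    Matrix.det_transpose]
  congr 2
  ext1 k
  by_cases h : k = i
  · subst h
    simp [Matrix.charmatrix_apply_eq]
  · simp [h]

/-- The coefficients of the adjugate of the characteristic matrix satisfy Horner's recursion. -/
theorem Matrix.adjugate_charmatrix_coeff_succ {n R : Type*} [Fintype n] [DecidableEq n]
    [CommRing R] (M : Matrix n n R) (k : ℕ) :
    M.charmatrix.adjugate.map (fun p => p.coeff k) =
      M * M.charmatrix.adjugate.map (fun p => p.coeff (k + 1)) +
        M.charpoly.coeff (k + 1) • (1 : Matrix n n R) := by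
  have h := M.charmatrix.mul_adjugate
  ext i j
  have hij := congrArg (fun p : Polynomial R => p.coeff (k + 1)) (congrFun (congrFun h i) j)
  rw [Matrix.charmatrix, sub_mul, ← Matrix.charmatrix, Matrix.sub_apply, Matrix.scalar_apply,
    Matrix.diagonal_mul, Matrix.mul_apply] at hij
  simp only [Polynomial.coeff_sub, Polynomial.coeff_X_mul, Polynomial.finsetSum_coeff,
    RingHom.mapMatrix_apply, Matrix.map_apply, Polynomial.coeff_C_mul, Matrix.smul_apply,
    smul_eq_mul] at hij
  have hone : (M.charmatrix.det * (1 : Matrix n n (Polynomial R)) i j).coeff (k + 1) =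
      M.charpoly.coeff (k + 1) * (1 : Matrix n n R) i j := by
    by_cases hij' : i = j
    · subst hij'
      simp [Matrix.charpoly]
    · simp [hij']
  rw [hone] at hij
  simp only [Matrix.map_apply, Matrix.add_apply, Matrix.mul_apply, Matrix.smul_apply, smul_eq_mul]
  linear_combination hij

/-- The coefficients of the adjugate of the characteristic matrix vanish from the size on. -/
theorem Matrix.adjugate_charmatrix_coeff_eq_zero {n R : Type*} [Fintype n] [DecidableEq n]
    [CommRing R] [Nontrivial R] (M : Matrix n n R) {k : ℕ} (hk : Fintype.card n ≤ k) :
    M.charmatrix.adjugate.map (fun p => p.coeff k) = 0 := by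
  have hpow : ∀ t, M.charmatrix.adjugate.map (fun p => p.coeff k) =
      M ^ t * M.charmatrix.adjugate.map (fun p => p.coeff (k + t)) := by
    intro t
    induction t with
    | zero => simp
    | succ t ih =>
      rw [ih, M.adjugate_charmatrix_coeff_succ (k + t), Polynomial.coeff_eq_zero_of_natDegree_lt,
        zero_smul, add_zero, pow_succ, mul_assoc, add_assoc]
      rw [M.charpoly_natDegree_eq_dim]
      lia
  rw [hpow (∑ i, ∑ j, (M.charmatrix.adjugate i j).natDegree + 1)]
  refine (congrArg _ ?_).trans (mul_zero _)
  ext i j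
  rw [Matrix.map_apply, Matrix.zero_apply]
  refine Polynomial.coeff_eq_zero_of_natDegree_lt ?_
  have h₁ : (M.charmatrix.adjugate i j).natDegree ≤ ∑ j, (M.charmatrix.adjugate i j).natDegree :=
    Finset.single_le_sum (f := fun j => (M.charmatrix.adjugate i j).natDegree)
      (fun _ _ => Nat.zero_le _) (Finset.mem_univ j)
  have h₂ : ∑ j, (M.charmatrix.adjugate i j).natDegree ≤
      ∑ i, ∑ j, (M.charmatrix.adjugate i j).natDegree :=
    Finset.single_le_sum (f := fun i => ∑ j, (M.charmatrix.adjugate i j).natDegree)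
      (fun _ _ => Nat.zero_le _) (Finset.mem_univ i)
  lia

/-- The coefficients of the adjugate of the characteristic matrix, in decreasing order, are the
Horner partial sums of the characteristic polynomial at the matrix. -/
theorem Matrix.adjugate_charmatrix_coeff {n R : Type*} [Fintype n] [DecidableEq n]
    [CommRing R] [Nontrivial R] (M : Matrix n n R) {m k : ℕ} (h : k + m + 1 = Fintype.card n) :
    M.charmatrix.adjugate.map (fun p => p.coeff k) =
      ∑ j ∈ Finset.range (m + 1), M.charpoly.coeff (Fintype.card n - j) • M ^ (m - j) := by
  induction m generalizing k with
  | zero =>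
    rw [M.adjugate_charmatrix_coeff_succ, M.adjugate_charmatrix_coeff_eq_zero (by lia)]
    simp [← h]
  | succ m ih =>
    rw [M.adjugate_charmatrix_coeff_succ, ih (by lia), Finset.sum_range_succ _ (m + 1),
      Finset.mul_sum]
    congr 1
    · refine Finset.sum_congr rfl fun j hj => ?_
      have hj' : m + 1 - j = (m - j) + 1 := by
        have := Finset.mem_range.1 hj
        lia
      rw [hj', pow_succ', Matrix.mul_smul]
    · rw [Nat.sub_self, pow_zero, ← h]
      congr 2
      lia

/-- **Newton's identities** for the coefficients of the characteristic polynomial and the traces of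
the powers of a matrix. -/
theorem Matrix.newton_charpoly {n R : Type*} [Fintype n] [DecidableEq n]
    [CommRing R] [Nontrivial R] (M : Matrix n n R) {m : ℕ} (hm : m ≤ Fintype.card n) :
    m * M.charpoly.coeff (Fintype.card n - m) +
      ∑ j ∈ Finset.range m, M.charpoly.coeff (Fintype.card n - j) * (M ^ (m - j)).trace = 0 := by
  rcases hm.lt_or_eq with hlt | rfl
  · obtain ⟨k, hk⟩ : ∃ k, k + m + 1 = Fintype.card n := ⟨Fintype.card n - m - 1, by lia⟩
    have hd := congrArg (fun p : Polynomial R => p.coeff k) M.derivative_charpoly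
    have ht := congrArg Matrix.trace (M.adjugate_charmatrix_coeff hk)
    have htr : (M.charmatrix.adjugate.map fun p => p.coeff k).trace =
        M.charmatrix.adjugate.trace.coeff k := by
      simp [Matrix.trace, Polynomial.finsetSum_coeff]
    rw [htr, ← hd, Polynomial.coeff_derivative, Finset.sum_range_succ, Matrix.trace_add,
      Matrix.trace_sum, Nat.sub_self, pow_zero, Matrix.trace_smul, Matrix.trace_one,
      show Fintype.card n - m = k + 1 by lia] at ht
    simp only [Matrix.trace_smul, smul_eq_mul] at ht
    rw [show Fintype.card n - m = k + 1 by lia]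
    have hc : (Fintype.card n : R) = k + m + 1 := by rw [← hk]; push_cast; ring
    rw [hc] at ht
    linear_combination -ht
  · have h := congrArg Matrix.trace M.aeval_self_charpoly
    rw [Polynomial.aeval_eq_sum_range, M.charpoly_natDegree_eq_dim, Matrix.trace_sum,
      ← Finset.sum_range_reflect, Finset.sum_range_succ] at h
    simp only [Matrix.trace_smul, smul_eq_mul, Matrix.trace_zero, Nat.add_sub_cancel,
      Nat.sub_self, pow_zero, Matrix.trace_one] at h
    rw [Nat.sub_self]
    linear_combination h

/-- Let `N ≥ 1` and let `M` be an `N×N` real matrix with `Tr M = 0` and with a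
nonzero kernel (equivalently `det M = 0`). For `k ≥ 1` set `s k = Tr(M^k)` (so `s 1 = 0`).
Let `H₀` be the `N×N` matrix (indexed by `Fin N`, i.e. `0`-based) whose superdiagonal entry in
row `i` is the `1`-based row index `i+1`, whose entries on and below the diagonal are
`H₀ i j = s (i - j + 1)`, and which vanishes above the superdiagonal. Then `det H₀ = 0`. -/
theorem hessenberg_obstruction_vanishes (N : ℕ) (hN : 1 ≤ N)
    (M : Matrix (Fin N) (Fin N) ℝ)
    (htr : M.trace = 0)
    (hker : ∃ v : Fin N → ℝ, v ≠ 0 ∧ M.mulVec v = 0)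
    (s : ℕ → ℝ) (hs : ∀ k, 1 ≤ k → s k = (M ^ k).trace)
    (H₀ : Matrix (Fin N) (Fin N) ℝ)
    (hH₀ : ∀ i j : Fin N, H₀ i j =
      if (j : ℕ) = (i : ℕ) + 1 then ((i : ℕ) + 1 : ℝ)
      else if (j : ℕ) ≤ (i : ℕ) then s ((i : ℕ) - (j : ℕ) + 1)
      else 0) :
    H₀.det = 0 := by
  have hdet : M.det = 0 := Matrix.exists_mulVec_eq_zero_iff.1 hker
  have hc0 : M.charpoly.coeff 0 = 0 := by
    have h := M.det_eq_sign_charpoly_coeff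
    rw [hdet] at h
    simpa using h.symm
  refine Matrix.exists_mulVec_eq_zero_iff.1 ⟨fun j => M.charpoly.coeff (N - j), ?_, ?_⟩
  · intro h
    have h0 := congrFun h ⟨0, hN⟩
    have hm := M.charpoly_monic.coeff_natDegree
    rw [M.charpoly_natDegree_eq_dim, Fintype.card_fin] at hm
    simp [hm] at h0
  · ext i
    have hnewton := M.newton_charpoly (m := i + 1) (by rw [Fintype.card_fin]; exact i.isLt)
    rw [Fintype.card_fin] at hnewton
    have hrow : H₀.mulVec (fun j : Fin N => M.charpoly.coeff (N - j)) i =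
        ∑ j : Fin N, ((if (j : ℕ) = i + 1 then ((i : ℕ) + 1 : ℝ) * M.charpoly.coeff (N - j)
          else 0) + if (j : ℕ) < i + 1 then
            M.charpoly.coeff (N - j) * (M ^ ((i : ℕ) + 1 - j)).trace else 0) := by
      rw [Matrix.mulVec, dotProduct]
      refine Finset.sum_congr rfl fun j _ => ?_
      rw [hH₀]
      rcases lt_trichotomy (j : ℕ) (i + 1) with h | h | h
      · rw [if_neg h.ne, if_neg h.ne, if_pos (by lia), if_pos h, hs _ (by lia),
          show (i : ℕ) - j + 1 = i + 1 - j by lia]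
        ring
      · simp [h]
      · rw [if_neg h.ne', if_neg h.ne', if_neg (by lia), if_neg (by lia)]
        ring
    rw [hrow, Fin.sum_univ_eq_sum_range (fun j : ℕ =>
        (if j = i + 1 then ((i : ℕ) + 1 : ℝ) * M.charpoly.coeff (N - j) else 0) +
          if j < i + 1 then M.charpoly.coeff (N - j) * (M ^ ((i : ℕ) + 1 - j)).trace else 0) N,
      Finset.sum_add_distrib, Finset.sum_ite_eq', ← Finset.sum_filter]
    have hfilter : (Finset.range N).filter (fun j => j < (i : ℕ) + 1) =
        Finset.range (i + 1) := by
      ext j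
      simp only [Finset.mem_filter, Finset.mem_range]
      lia
    have hlast : (if (i : ℕ) + 1 ∈ Finset.range N then
        ((i : ℕ) + 1 : ℝ) * M.charpoly.coeff (N - (i + 1)) else 0) =
          ((i : ℕ) + 1 : ℝ) * M.charpoly.coeff (N - (i + 1)) := by
      split_ifs with h
      · rfl
      · rw [Finset.mem_range] at h
        rw [show N - ((i : ℕ) + 1) = 0 by lia, hc0, mul_zero]
    rw [hfilter, hlast]
    push_cast at hnewton
    exact hnewton
end

section
/- Let n ≥ 2 and let C : Fin n → Fin n → Fin n → Fin n → ℝ have Weyl symmetries. Then for every 2-form X on ℝⁿ, the endomorphism β_X of the space of 2-forms is traceless: Tr(β_X) = 0. -/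
open Matrix

noncomputable section

/-- The space of 2-forms on `ℝⁿ`, realised as the submodule of skew-symmetric `n×n` real
matrices; it is a real vector space of dimension `N = n(n-1)/2`. -/
def twoForms (n : ℕ) : Submodule ℝ (Matrix (Fin n) (Fin n) ℝ) where
  carrier := {A | Aᵀ = -A}
  add_mem' := by
    intro A B hA hB
    simp only [Set.mem_setOf_eq] at *
    rw [Matrix.transpose_add, hA, hB, neg_add]
  zero_mem' := by simp
  smul_mem' := by
    intro c A hA
    simp only [Set.mem_setOf_eq] at *
    rw [Matrix.transpose_smul, hA, smul_neg]

lemma mem_twoForms {n : ℕ} {A : Matrix (Fin n) (Fin n) ℝ} :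
    A ∈ twoForms n ↔ Aᵀ = -A := Iff.rfl

/-- The underlying matrix of `β_X φ`:
`(β_X φ)_{ad} = ∑_{b,c,e} X_{bc} ( ½(C_{bca}{}^e φ_{de} − C_{bcd}{}^e φ_{ae})
  + ½(C_{adb}{}^e φ_{ce} − C_{adc}{}^e φ_{be}) )`. -/
def betaFun {n : ℕ} (C : Fin n → Fin n → Fin n → Fin n → ℝ)
    (X : Matrix (Fin n) (Fin n) ℝ) (φ : Matrix (Fin n) (Fin n) ℝ) :
    Matrix (Fin n) (Fin n) ℝ :=
  Matrix.of fun a d => ∑ b, ∑ c, ∑ e, X b c *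
    ((1 / 2) * (C b c a e * φ d e - C b c d e * φ a e) +
     (1 / 2) * (C a d b e * φ c e - C a d c e * φ b e))

/-- The endomorphism `β_X` of the space of 2-forms, for a 4-tensor `C` that is skew in its
first two indices (as any tensor with Weyl symmetries is). -/
def betaX {n : ℕ} (C : Fin n → Fin n → Fin n → Fin n → ℝ)
    (hC : ∀ a b c d, C a b c d = -C b a c d)
    (X : Matrix (Fin n) (Fin n) ℝ) :
    twoForms n →ₗ[ℝ] twoForms n where
  toFun φ := ⟨betaFun C X φ.1, by
    rw [mem_twoForms]
    ext a d
    simp only [Matrix.transpose_apply, Matrix.neg_apply, betaFun, Matrix.of_apply]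
    rw [← Finset.sum_neg_distrib]
    refine Finset.sum_congr rfl fun b _ => ?_
    rw [← Finset.sum_neg_distrib]
    refine Finset.sum_congr rfl fun c _ => ?_
    rw [← Finset.sum_neg_distrib]
    refine Finset.sum_congr rfl fun e _ => ?_
    rw [hC d a b e, hC d a c e]
    ring⟩
  map_add' := by
    intro φ ψ
    apply Subtype.ext
    show betaFun C X (φ.1 + ψ.1) = betaFun C X φ.1 + betaFun C X ψ.1
    ext a d
    simp only [betaFun, Matrix.of_apply, Matrix.add_apply]
    rw [← Finset.sum_add_distrib]
    refine Finset.sum_congr rfl fun b _ => ?_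
    rw [← Finset.sum_add_distrib]
    refine Finset.sum_congr rfl fun c _ => ?_
    rw [← Finset.sum_add_distrib]
    refine Finset.sum_congr rfl fun e _ => ?_
    ring
  map_smul' := by
    intro r φ
    apply Subtype.ext
    show betaFun C X (r • φ.1) = r • betaFun C X φ.1
    ext a d
    simp only [betaFun, Matrix.of_apply, Matrix.smul_apply, smul_eq_mul]
    rw [Finset.mul_sum]
    refine Finset.sum_congr rfl fun b _ => ?_
    rw [Finset.mul_sum]
    refine Finset.sum_congr rfl fun c _ => ?_
    rw [Finset.mul_sum]
    refine Finset.sum_congr rfl fun e _ => ?_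
    ring

lemma LinearMap.trace_eq_sum_single {R m n : Type*} [CommRing R] [Fintype m] [Fintype n]
    [DecidableEq m] [DecidableEq n] (f : Matrix m n R →ₗ[R] Matrix m n R) :
    LinearMap.trace R (Matrix m n R) f = ∑ a, ∑ d, f (Matrix.single a d 1) a d := by
  rw [LinearMap.trace_eq_matrix_trace R (Matrix.stdBasis R m n), Matrix.trace,
    Fintype.sum_prod_type]
  refine Finset.sum_congr rfl fun a _ => Finset.sum_congr rfl fun d _ => ?_
  rw [Matrix.diag_apply, LinearMap.toMatrix_apply, Matrix.stdBasis_eq_single]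
  conv_rhs => rw [← (Matrix.stdBasis R m n).sum_repr (f (Matrix.single a d 1))]
  simp [Matrix.sum_apply, Matrix.stdBasis_eq_single, Fintype.sum_prod_type, Matrix.single_apply,
    ite_and]

/-- The projection of a matrix onto its skew-symmetric part. -/
def skewPart (n : ℕ) : Matrix (Fin n) (Fin n) ℝ →ₗ[ℝ] twoForms n where
  toFun A := ⟨(1 / 2 : ℝ) • (A - Aᵀ), by
    rw [mem_twoForms, Matrix.transpose_smul, Matrix.transpose_sub, Matrix.transpose_transpose,
      ← smul_neg, neg_sub]⟩
  map_add' A B := by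
    ext i j
    simp
    ring
  map_smul' r A := by
    ext i j
    simp
    ring

lemma skewPart_comp_subtype (n : ℕ) : skewPart n ∘ₗ (twoForms n).subtype = LinearMap.id := by
  refine LinearMap.ext fun φ => Subtype.ext ?_
  have h : (φ : Matrix (Fin n) (Fin n) ℝ)ᵀ = -φ := φ.2
  ext i j
  simp [skewPart, h]
  ring

lemma trace_twoForms_eq_sum {n : ℕ} (T : twoForms n →ₗ[ℝ] twoForms n) :
    LinearMap.trace ℝ (twoForms n) T =
      ∑ a, ∑ d, (T (skewPart n (Matrix.single a d 1))).1 a d := by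
  calc LinearMap.trace ℝ (twoForms n) T
      = LinearMap.trace ℝ (twoForms n) ((T ∘ₗ skewPart n) ∘ₗ (twoForms n).subtype) := by
        rw [LinearMap.comp_assoc, skewPart_comp_subtype, LinearMap.comp_id]
    _ = LinearMap.trace ℝ _ ((twoForms n).subtype ∘ₗ (T ∘ₗ skewPart n)) :=
        LinearMap.trace_comp_comm' _ _
    _ = _ := LinearMap.trace_eq_sum_single _

lemma betaFun_skewPart_single_apply {n : ℕ} (C : Fin n → Fin n → Fin n → Fin n → ℝ)
    (hC2 : ∀ a b c d, C a b c d = -C a b d c) (X : Matrix (Fin n) (Fin n) ℝ) (a d : Fin n) :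
    betaFun C X (skewPart n (Matrix.single a d 1)).1 a d =
      ∑ b, (1 / 4) * ((X b a - X a b) * C a d b d - (X b d - X d b) * C a d b a) := by
  have h0 : ∀ a b c, C a b c c = 0 := fun a b c => by linarith [hC2 a b c c]
  have hφ : ∀ x y, (skewPart n (Matrix.single a d 1)).1 x y =
      (1 / 2) * ((if a = x then 1 else 0) * (if d = y then 1 else 0) -
        (if d = x then 1 else 0) * (if a = y then 1 else 0)) := fun x y => by
    simp [skewPart, Matrix.single_apply, ite_and]
    split_ifs <;> rfl
  have hsum : ∀ b c, ∑ e, X b c *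
      ((1 / 2) * (C b c a e * (skewPart n (Matrix.single a d 1)).1 d e -
          C b c d e * (skewPart n (Matrix.single a d 1)).1 a e) +
        (1 / 2) * (C a d b e * (skewPart n (Matrix.single a d 1)).1 c e -
          C a d c e * (skewPart n (Matrix.single a d 1)).1 b e)) =
      (1 / 4) * X b c * ((if a = c then C a d b d else 0) - (if d = c then C a d b a else 0)) -
      (1 / 4) * X b c * ((if a = b then C a d c d else 0) - (if d = b then C a d c a else 0)) := by
    intro b c
    have key : ∀ (F : Fin n → ℝ) x, ∑ e, F e * (skewPart n (Matrix.single a d 1)).1 x e =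
        (1 / 2) * ((if a = x then F d else 0) - (if d = x then F a else 0)) := by
      intro F x
      simp_rw [hφ]
      simp [mul_sub, Finset.sum_sub_distrib]
      split_ifs <;> ring
    rw [← Finset.mul_sum, Finset.sum_add_distrib, ← Finset.mul_sum, ← Finset.mul_sum,
      Finset.sum_sub_distrib, Finset.sum_sub_distrib, key, key, key, key, h0, h0]
    by_cases had : a = d
    · subst had
      simp only [h0]
      ring
    · simp only [had, Ne.symm had, if_false, if_true]
      ring
  simp only [betaFun, Matrix.of_apply, hsum]
  simp only [Finset.sum_sub_distrib, mul_sub, sub_mul]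
  rw [Finset.sum_comm (f := fun b c => 1 / 4 * X b c * (if a = b then C a d c d else 0)),
    Finset.sum_comm (f := fun b c => 1 / 4 * X b c * (if d = b then C a d c a else 0))]
  simp [mul_assoc]
  ring

/-- Let `n ≥ 2` and let `C` have Weyl symmetries. Then for every 2-form `X`
on `ℝⁿ`, the endomorphism `β_X` of the space of 2-forms is traceless: `Tr(β_X) = 0`. -/
theorem betaX_traceless (n : ℕ) (hn : 2 ≤ n)
    (C : Fin n → Fin n → Fin n → Fin n → ℝ)
    (hC1 : ∀ a b c d, C a b c d = -C b a c d)
    (hC2 : ∀ a b c d, C a b c d = -C a b d c)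
    (hC3 : ∀ a b c d, C a b c d = C c d a b)
    (hBianchi : ∀ a b c d, C a b c d + C a c d b + C a d b c = 0)
    (hTraceFree : ∀ b d, ∑ a, C a b a d = 0)
    (X : Matrix (Fin n) (Fin n) ℝ) (hX : Xᵀ = -X) :
    LinearMap.trace ℝ (twoForms n) (betaX C hC1 X) = 0 := by
  have h1 : ∀ a b, ∑ d, C a d b d = 0 := fun a b => by
    rw [← hTraceFree a b]
    exact Finset.sum_congr rfl fun d _ => by rw [hC1, hC2, neg_neg]
  have h2 : ∀ b d, ∑ a, C a d b a = 0 := fun b d => by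
    simp_rw [hC2 _ d b, Finset.sum_neg_distrib, hTraceFree, neg_zero]
  rw [trace_twoForms_eq_sum]
  change ∑ a, ∑ d, betaFun C X (skewPart n (Matrix.single a d 1)).1 a d = 0
  simp_rw [betaFun_skewPart_single_apply C hC2, ← Finset.mul_sum, Finset.sum_sub_distrib]
  have e1 : ∑ a, ∑ d, ∑ b, (X b a - X a b) * C a d b d = 0 :=
    Finset.sum_eq_zero fun a _ => by
      rw [Finset.sum_comm]
      exact Finset.sum_eq_zero fun b _ => by rw [← Finset.mul_sum, h1, mul_zero]
  have e2 : ∑ a, ∑ d, ∑ b, (X b d - X d b) * C a d b a = 0 := by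
    rw [Finset.sum_comm]
    refine Finset.sum_eq_zero fun d _ => ?_
    rw [Finset.sum_comm]
    exact Finset.sum_eq_zero fun b _ => by rw [← Finset.mul_sum, h2, mul_zero]
  rw [e1, e2, sub_zero, mul_zero]

end
end

section
/- Let n ≥ 2, set N = n(n−1)/2, and let C : Fin n → Fin n → Fin n → Fin n → ℝ have Weyl symmetries. Suppose there exists a nonzero 2-form ω on ℝⁿ satisfying the Weyl compatibility condition: for all a, b, c, d, (1/2)·∑ e, (C b c a e · ω d e − C b c d e · ω a e + C a d b e · ω c e − C a d c e · ω b e) = 0. Then for every 2-form X on ℝⁿ the following obstruction vanishes: det(H) = 0, where s_k := Tr(β_X^k) for k = 1,…,N, and H is the N×N real matrix with H i (i+1) = i for 1 ≤ i ≤ N−1, H i j = s_{i−j+1} for j ≤ i, and H i j = 0 for j > i+1. -/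
open Matrix

noncomputable section

namespace Matrix

open Polynomial

section CommRing

variable {m R : Type*} [Fintype m] [DecidableEq m] [CommRing R]

/-- **Jacobi's formula** for the derivative of the determinant of a polynomial matrix. -/
lemma derivative_det_eq_trace_adjugate_mul (M : Matrix m m R[X]) :
    derivative M.det = (M.adjugate * M.map derivative).trace := by
  have hcol (i : m) : (M.adjugate * M.map derivative) i i =
      (M.updateCol i fun k => derivative (M k i)).det := by
    rw [← cramer_apply, cramer_eq_adjugate_mulVec]
    rfl
  simp only [trace, diag_apply, hcol]
  simp only [det_apply', derivative_sum]
  rw [Finset.sum_comm]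
  refine Finset.sum_congr rfl fun σ _ => ?_
  rw [derivative_intCast_mul, derivative_prod_finset, Finset.mul_sum]
  refine Finset.sum_congr rfl fun i _ => ?_
  rw [← Finset.mul_prod_erase _ _ (Finset.mem_univ i), updateCol_self, mul_comm (derivative _)]
  congr 2
  refine Finset.prod_congr rfl fun j hj => ?_
  rw [updateCol_ne (Finset.ne_of_mem_erase hj)]

/-- The coefficients of the adjugate of `1 - X • A`. -/
lemma adjugate_one_sub_X_smul_map_coeff (A : Matrix m m R) (k : ℕ) :
    ((1 - (X : R[X]) • A.map C).adjugate.map fun p => p.coeff k) =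
      ∑ j ∈ Finset.range (k + 1), A.charpolyRev.coeff j • A ^ (k - j) := by
  set B := (1 - (X : R[X]) • A.map C).adjugate with hB
  have hmul : B = A.charpolyRev • 1 + (X : R[X]) • (B * A.map C) := by
    have h := adjugate_mul (1 - (X : R[X]) • A.map C)
    rw [← hB, mul_sub, mul_one, mul_smul_comm, sub_eq_iff_eq_add] at h
    exact h
  have hentry (i j : m) :
      B i j = A.charpolyRev * (1 : Matrix m m R[X]) i j + X * ∑ l, B i l * C (A l j) := by
    conv_lhs => rw [hmul]
    simp [mul_apply]
  have hone (p : R[X]) (i j : m) (k : ℕ) :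
      (p * (1 : Matrix m m R[X]) i j).coeff k = p.coeff k * (1 : Matrix m m R) i j := by
    rcases eq_or_ne i j with rfl | hij <;> simp [*]
  induction k with
  | zero =>
    ext i j
    simp [hentry i j, hone]
  | succ k ih =>
    have hstep : (B.map fun p => p.coeff (k + 1)) =
        A.charpolyRev.coeff (k + 1) • 1 + (B.map fun p => p.coeff k) * A := by
      ext i j
      simp [hentry i j, hone, mul_apply, coeff_X_mul]
    rw [hstep, ih, Finset.sum_range_succ _ (k + 1), Finset.sum_mul, add_comm]
    congr 1
    · refine Finset.sum_congr rfl fun j hj => ?_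
      rw [smul_mul, ← pow_succ, Nat.succ_sub (Nat.lt_succ_iff.mp (Finset.mem_range.mp hj))]
    · simp

/-- **Newton's identities** for the traces of the powers of a matrix. -/
lemma sum_trace_pow_mul_coeff_charpolyRev (A : Matrix m m R) (k : ℕ) :
    ∑ j ∈ Finset.range (k + 1), (A ^ (k - j + 1)).trace * A.charpolyRev.coeff j +
      (k + 1) * A.charpolyRev.coeff (k + 1) = 0 := by
  have hderiv : (1 - (X : R[X]) • A.map C).map derivative = -A.map C := by
    ext1 i j
    rcases eq_or_ne i j with rfl | hij <;> simp [*]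
  have hcoeff := congrArg (fun p => p.coeff k)
    (derivative_det_eq_trace_adjugate_mul (1 - (X : R[X]) • A.map C))
  rw [hderiv] at hcoeff
  have htrace : (((1 - (X : R[X]) • A.map C).adjugate * -A.map C).trace).coeff k =
      -(((1 - (X : R[X]) • A.map C).adjugate.map fun p => p.coeff k) * A).trace := by
    simp [trace, mul_apply]
  simp only [htrace, adjugate_one_sub_X_smul_map_coeff, coeff_derivative] at hcoeff
  change A.charpolyRev.coeff (k + 1) * _ = _ at hcoeff
  rw [mul_comm, hcoeff, Finset.sum_mul, trace_sum, ← sub_eq_add_neg, sub_eq_zero]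
  refine Finset.sum_congr rfl fun j _ => ?_
  rw [smul_mul, trace_smul, ← pow_succ, smul_eq_mul, mul_comm]

end CommRing

lemma coeff_charpolyRev_eq_zero_of_det_eq_zero {m K : Type*} [Fintype m] [DecidableEq m]
    [Field K] {A : Matrix m m K} (hA : A.det = 0) {N : ℕ} (hN : Fintype.card m ≤ N) :
    A.charpolyRev.coeff N = 0 := by
  rw [← reverse_charpoly]
  rcases hN.lt_or_eq with h | rfl
  · exact coeff_eq_zero_of_natDegree_lt
      ((reverse_natDegree_le _).trans_lt (by rwa [charpoly_natDegree_eq_dim]))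
  · rw [← charpoly_natDegree_eq_dim A, reverse, coeff_reflect, revAt_le le_rfl, Nat.sub_self]
    have h := det_eq_sign_charpoly_coeff A
    rw [hA] at h
    simpa using h.symm

/-- The Hessenberg determinant of the traces of the powers of a singular matrix vanishes. -/
lemma det_hessenberg_trace_pow_eq_zero {m K : Type*} [Fintype m] [DecidableEq m]
    [Field K] {A : Matrix m m K} (hA : A.det = 0) {N : ℕ} (hN : Fintype.card m ≤ N)
    (hpos : 0 < N) {H : Matrix (Fin N) (Fin N) K}
    (hH : ∀ i j : Fin N, H i j =
      if (j : ℕ) = (i : ℕ) + 1 then ((i : ℕ) + 1 : K)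
      else if (j : ℕ) ≤ (i : ℕ) then (A ^ ((i : ℕ) - (j : ℕ) + 1)).trace
      else 0) :
    H.det = 0 := by
  refine exists_mulVec_eq_zero_iff.mp ⟨fun j => A.charpolyRev.coeff j, fun h => ?_, ?_⟩
  · have h0 := congrFun h ⟨0, hpos⟩
    simp [coeff_zero_eq_eval_zero] at h0
  · ext i
    set f : ℕ → K := fun j =>
      (if j = (i : ℕ) + 1 then ((i : ℕ) + 1 : K)
        else if j ≤ (i : ℕ) then (A ^ ((i : ℕ) - j + 1)).trace else 0) * A.charpolyRev.coeff j
      with hf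
    have hsum : (H *ᵥ fun j => A.charpolyRev.coeff j) i = ∑ j ∈ Finset.range N, f j := by
      rw [← Fin.sum_univ_eq_sum_range]
      simp only [mulVec, dotProduct, hH, hf]
    have hfN : f N = 0 := by
      simp [hf, coeff_charpolyRev_eq_zero_of_det_eq_zero hA hN]
    have hext : ∑ j ∈ Finset.range N, f j = ∑ j ∈ Finset.range (i + 2), f j := by
      rw [← add_zero (∑ j ∈ Finset.range N, f j), ← hfN, ← Finset.sum_range_succ]
      refine (Finset.sum_subset (Finset.range_subset_range.mpr (by lia)) fun j _ hj => ?_).symm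
      rw [Finset.mem_range] at hj
      simp only [hf]
      rw [if_neg (by lia), if_neg (by lia), zero_mul]
    rw [hsum, hext, Finset.sum_range_succ, Pi.zero_apply,
      ← sum_trace_pow_mul_coeff_charpolyRev A i]
    congr 1
    · refine Finset.sum_congr rfl fun j hj => ?_
      rw [Finset.mem_range] at hj
      simp only [hf]
      rw [if_neg (by lia), if_pos (by lia)]
    · simp [hf]

end Matrix

lemma finrank_twoForms_le (n : ℕ) : Module.finrank ℝ (twoForms n) ≤ n * (n - 1) / 2 := by
  let f : twoForms n →ₗ[ℝ] ((Σ i : Fin n, Fin i) → ℝ) :=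
    { toFun φ p := φ.1 p.1 (p.2.castLE p.1.2.le)
      map_add' _ _ := rfl
      map_smul' _ _ := rfl }
  have hf : Function.Injective f := by
    rw [← LinearMap.ker_eq_bot, LinearMap.ker_eq_bot']
    intro φ hφ
    have hlt (i j : Fin n) (hij : j < i) : φ.1 i j = 0 := congrFun hφ ⟨i, ⟨j, hij⟩⟩
    have hskew (i j : Fin n) : φ.1 j i = -φ.1 i j :=
      congrFun (congrFun (mem_twoForms.mp φ.2) i) j
    ext i j
    rcases lt_trichotomy i j with h | rfl | h
    · exact (hskew j i).trans (neg_eq_zero.mpr (hlt j i h))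
    · simpa using self_eq_neg.mp (hskew i i)
    · exact hlt i j h
  refine (LinearMap.finrank_le_finrank_of_injective hf).trans_eq ?_
  rw [Module.finrank_fintype_fun_eq_card, Fintype.card_sigma]
  simp only [Fintype.card_fin]
  rw [Fin.sum_univ_eq_sum_range fun i => i, Finset.sum_range_id]

lemma betaFun_eq_zero_of_compat {n : ℕ} {C : Fin n → Fin n → Fin n → Fin n → ℝ}
    {ω : Matrix (Fin n) (Fin n) ℝ}
    (hcompat : ∀ a b c d, (1 / 2 : ℝ) * ∑ e,
      (C b c a e * ω d e - C b c d e * ω a e + C a d b e * ω c e - C a d c e * ω b e) = 0)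
    (X : Matrix (Fin n) (Fin n) ℝ) : betaFun C X ω = 0 := by
  ext a d
  simp only [betaFun, Matrix.of_apply, Matrix.zero_apply]
  refine Finset.sum_eq_zero fun b _ => Finset.sum_eq_zero fun c _ => ?_
  rw [← mul_zero (X b c), ← hcompat a b c d, Finset.mul_sum, Finset.mul_sum]
  exact Finset.sum_congr rfl fun e _ => by ring

/-- Let `n ≥ 2`, set `N = n(n−1)/2`, let `C` have Weyl symmetries, and
suppose there is a nonzero 2-form `ω` on `ℝⁿ` satisfying the Weyl compatibility condition.
Then for every 2-form `X` on `ℝⁿ` the Bell-polynomial obstruction vanishes: `det H = 0`,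
where `s k = Tr(β_X ^ k)` for `k = 1, …, N` and `H` is the `N×N` lower-Hessenberg matrix
(indexed by `Fin N`, i.e. `0`-based) with superdiagonal entry `i+1` in row `i`, entries
`s (i − j + 1)` on and below the diagonal, and `0` above the superdiagonal. -/
theorem bell_polynomial_obstruction (n : ℕ) (hn : 2 ≤ n)
    (N : ℕ) (hN : N = n * (n - 1) / 2)
    (C : Fin n → Fin n → Fin n → Fin n → ℝ)
    (hC1 : ∀ a b c d, C a b c d = -C b a c d)
    (hC2 : ∀ a b c d, C a b c d = -C a b d c)
    (hC3 : ∀ a b c d, C a b c d = C c d a b)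
    (hBianchi : ∀ a b c d, C a b c d + C a c d b + C a d b c = 0)
    (hTraceFree : ∀ b d, ∑ a, C a b a d = 0)
    (ω : Matrix (Fin n) (Fin n) ℝ) (hω_skew : ωᵀ = -ω) (hω_ne : ω ≠ 0)
    (hcompat : ∀ a b c d, (1 / 2 : ℝ) * ∑ e,
      (C b c a e * ω d e - C b c d e * ω a e + C a d b e * ω c e - C a d c e * ω b e) = 0)
    (X : Matrix (Fin n) (Fin n) ℝ) (hX : Xᵀ = -X)
    (s : ℕ → ℝ)
    (hs : ∀ k, 1 ≤ k → k ≤ N → s k = LinearMap.trace ℝ (twoForms n) (betaX C hC1 X ^ k))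
    (H : Matrix (Fin N) (Fin N) ℝ)
    (hH : ∀ i j : Fin N, H i j =
      if (j : ℕ) = (i : ℕ) + 1 then ((i : ℕ) + 1 : ℝ)
      else if (j : ℕ) ≤ (i : ℕ) then s ((i : ℕ) - (j : ℕ) + 1)
      else 0) :
    H.det = 0 := by
  have hdet : LinearMap.det (betaX C hC1 X) = 0 := by
    by_contra h
    have hker := (LinearMap.equivOfDetNeZero _ h).injective.eq_iff (a := ⟨ω, hω_skew⟩) (b := 0)
    refine hω_ne (congrArg Subtype.val (hker.mp ?_))
    rw [map_zero]
    exact Subtype.ext (betaFun_eq_zero_of_compat hcompat X)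
  let b := Module.finBasis ℝ (twoForms n)
  have hpos : 0 < N := by
    have : 2 * 1 ≤ n * (n - 1) := Nat.mul_le_mul hn (by lia)
    lia
  refine Matrix.det_hessenberg_trace_pow_eq_zero (A := LinearMap.toMatrix b b (betaX C hC1 X))
    (by rwa [LinearMap.det_toMatrix]) (by simpa [hN] using finrank_twoForms_le n) hpos ?_
  intro i j
  rw [hH]
  refine if_congr Iff.rfl rfl ?_
  split_ifs with hij
  · rw [hs _ (by lia) (by lia), LinearMap.trace_eq_matrix_trace ℝ b, LinearMap.toMatrix_pow]
  · rfl

end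
end

section
/- Let n ≥ 2, let C : Fin n → Fin n → Fin n → Fin n → ℝ have Weyl symmetries, and let ω be a 2-form on ℝⁿ. Define two linear endomorphisms of the space of 2-forms: Ĉ(φ) a b := ∑ c d, C c d a b · φ c d, and ω̂(φ) a b := (1/2)·∑ c, (ω a c · φ b c − ω b c · φ a c). Then the following are equivalent: (i) for all a, b, c, d, (1/2)·∑ e, (C b c a e · ω d e − C b c d e · ω a e + C a d b e · ω c e − C a d c e · ω b e) = 0; (ii) Ĉ ∘ ω̂ = ω̂ ∘ Ĉ. -/
open Matrix

noncomputable section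

/-- The endomorphism `Ĉ` of the space of 2-forms, `Ĉ(φ)_{ab} = ∑_{c,d} C_{cdab} φ_{cd}`,
for a 4-tensor `C` that is skew in its last two indices (as any tensor with Weyl symmetries
is). -/
def cHat {n : ℕ} (C : Fin n → Fin n → Fin n → Fin n → ℝ)
    (hC : ∀ a b c d, C a b c d = -C a b d c) :
    twoForms n →ₗ[ℝ] twoForms n where
  toFun φ := ⟨Matrix.of fun a b => ∑ c, ∑ d, C c d a b * φ.1 c d, by
    rw [mem_twoForms]
    ext a b
    simp only [Matrix.transpose_apply, Matrix.neg_apply, Matrix.of_apply]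
    rw [← Finset.sum_neg_distrib]
    refine Finset.sum_congr rfl fun c _ => ?_
    rw [← Finset.sum_neg_distrib]
    refine Finset.sum_congr rfl fun d _ => ?_
    rw [hC c d a b]
    ring⟩
  map_add' := by
    intro φ ψ
    apply Subtype.ext
    show (Matrix.of fun a b => ∑ c, ∑ d, C c d a b * (φ.1 + ψ.1) c d)
        = (Matrix.of fun a b => ∑ c, ∑ d, C c d a b * φ.1 c d)
          + (Matrix.of fun a b => ∑ c, ∑ d, C c d a b * ψ.1 c d)
    ext a b
    simp only [Matrix.of_apply, Matrix.add_apply]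
    rw [← Finset.sum_add_distrib]
    refine Finset.sum_congr rfl fun c _ => ?_
    rw [← Finset.sum_add_distrib]
    refine Finset.sum_congr rfl fun d _ => ?_
    ring
  map_smul' := by
    intro r φ
    apply Subtype.ext
    show (Matrix.of fun a b => ∑ c, ∑ d, C c d a b * (r • φ.1) c d)
        = r • (Matrix.of fun a b => ∑ c, ∑ d, C c d a b * φ.1 c d)
    ext a b
    simp only [Matrix.of_apply, Matrix.smul_apply, smul_eq_mul]
    rw [Finset.mul_sum]
    refine Finset.sum_congr rfl fun c _ => ?_
    rw [Finset.mul_sum]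
    refine Finset.sum_congr rfl fun d _ => ?_
    ring

/-- The endomorphism `ω̂` of the space of 2-forms,
`ω̂(φ)_{ab} = ½ ∑_c (ω_{ac} φ_{bc} − ω_{bc} φ_{ac})`. -/
def omegaHat {n : ℕ} (ω : Matrix (Fin n) (Fin n) ℝ) :
    twoForms n →ₗ[ℝ] twoForms n where
  toFun φ := ⟨Matrix.of fun a b => (1 / 2) * ∑ c, (ω a c * φ.1 b c - ω b c * φ.1 a c), by
    rw [mem_twoForms]
    ext a b
    simp only [Matrix.transpose_apply, Matrix.neg_apply, Matrix.of_apply]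
    rw [← mul_neg, ← Finset.sum_neg_distrib]
    congr 1
    refine Finset.sum_congr rfl fun c _ => ?_
    ring⟩
  map_add' := by
    intro φ ψ
    apply Subtype.ext
    show (Matrix.of fun a b =>
        (1 / 2) * ∑ c, (ω a c * (φ.1 + ψ.1) b c - ω b c * (φ.1 + ψ.1) a c))
      = (Matrix.of fun a b => (1 / 2) * ∑ c, (ω a c * φ.1 b c - ω b c * φ.1 a c))
        + (Matrix.of fun a b => (1 / 2) * ∑ c, (ω a c * ψ.1 b c - ω b c * ψ.1 a c))
    ext a b
    simp only [Matrix.of_apply, Matrix.add_apply]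
    rw [← mul_add, ← Finset.sum_add_distrib]
    congr 1
    refine Finset.sum_congr rfl fun c _ => ?_
    ring
  map_smul' := by
    intro r φ
    apply Subtype.ext
    show (Matrix.of fun a b =>
        (1 / 2) * ∑ c, (ω a c * (r • φ.1) b c - ω b c * (r • φ.1) a c))
      = r • (Matrix.of fun a b => (1 / 2) * ∑ c, (ω a c * φ.1 b c - ω b c * φ.1 a c))
    ext a b
    simp only [Matrix.of_apply, Matrix.smul_apply, smul_eq_mul]
    conv_rhs => rw [mul_left_comm, Finset.mul_sum]
    congr 1
    refine Finset.sum_congr rfl fun c _ => ?_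
    ring

/-- Twice the Weyl compatibility expression: the action of `ω` as a derivation on the
component `C b c a d`. -/
def weylAction {n : ℕ} (C : Fin n → Fin n → Fin n → Fin n → ℝ)
    (ω : Matrix (Fin n) (Fin n) ℝ) (a b c d : Fin n) : ℝ :=
  ∑ e, (C b c a e * ω d e - C b c d e * ω a e + C a d b e * ω c e - C a d c e * ω b e)

lemma weylAction_swap {n : ℕ} {C : Fin n → Fin n → Fin n → Fin n → ℝ}
    (hC1 : ∀ a b c d, C a b c d = -C b a c d) (ω : Matrix (Fin n) (Fin n) ℝ)
    (a b c d : Fin n) : weylAction C ω a c b d = -weylAction C ω a b c d := by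
  simp only [weylAction, ← Finset.sum_neg_distrib]
  refine Finset.sum_congr rfl fun e _ => ?_
  rw [hC1 c b a e, hC1 c b d e]
  ring

/-- The commutator of `Ĉ` and `ω̂` is the endomorphism of 2-forms given by half of the
tensor `weylAction C ω`. -/
lemma commutator_apply {n : ℕ} {C : Fin n → Fin n → Fin n → Fin n → ℝ}
    (hC2 : ∀ a b c d, C a b c d = -C a b d c)
    (hC3 : ∀ a b c d, C a b c d = C c d a b)
    {ω : Matrix (Fin n) (Fin n) ℝ} (hω_skew : ωᵀ = -ω) (φ : twoForms n) (a b : Fin n) :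
    (cHat C hC2 (omegaHat ω φ)).1 a b - (omegaHat ω (cHat C hC2 φ)).1 a b =
      (1 / 2) * ∑ c, ∑ d, weylAction C ω a c d b * φ.1 c d := by
  have hω (i j) : ω i j = -ω j i := congrFun (congrFun hω_skew j) i
  have hφ (i j) : φ.1 i j = -φ.1 j i := congrFun (congrFun (mem_twoForms.1 φ.2) j) i
  have h₁ : ∑ c, ∑ d, ∑ e, C a b c e * ω d e * φ.1 c d =
      -∑ c, ∑ d, ∑ e, C c d a b * ω d e * φ.1 c e := by
    simp only [← Finset.sum_neg_distrib]
    refine Finset.sum_congr rfl fun c _ => ?_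
    rw [Finset.sum_comm]
    refine Finset.sum_congr rfl fun d _ => Finset.sum_congr rfl fun e _ => ?_
    rw [hC3 a b c d, hω e d]
    ring
  have h₂ : ∑ c, ∑ d, ∑ e, C a b d e * ω c e * φ.1 c d =
      -∑ c, ∑ d, ∑ e, C c d a b * ω c e * φ.1 d e := by
    simp only [← Finset.sum_neg_distrib]
    rw [Finset.sum_congr rfl fun c _ => Finset.sum_comm, Finset.sum_comm]
    refine Finset.sum_congr rfl fun c _ => ?_
    rw [Finset.sum_comm]
    refine Finset.sum_congr rfl fun d _ => Finset.sum_congr rfl fun e _ => ?_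
    rw [hC2 a b d c, hC3 a b c d, hω e c, hφ e d]
    ring
  have h₃ (i j : Fin n) : ∑ e, ω i e * ∑ c, ∑ d, C c d j e * φ.1 c d =
      ∑ c, ∑ d, ∑ e, C c d j e * ω i e * φ.1 c d := by
    simp only [Finset.mul_sum]
    rw [Finset.sum_comm]
    refine Finset.sum_congr rfl fun c _ => ?_
    rw [Finset.sum_comm]
    refine Finset.sum_congr rfl fun d _ => Finset.sum_congr rfl fun e _ => ?_
    ring
  have hl : (cHat C hC2 (omegaHat ω φ)).1 a b = (1 / 2) *
      (∑ c, ∑ d, ∑ e, C c d a b * ω c e * φ.1 d e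
        - ∑ c, ∑ d, ∑ e, C c d a b * ω d e * φ.1 c e) := by
    change ∑ c, ∑ d, C c d a b * ((1 / 2) * ∑ e, (ω c e * φ.1 d e - ω d e * φ.1 c e)) = _
    simp only [← Finset.sum_sub_distrib, Finset.mul_sum]
    refine Finset.sum_congr rfl fun c _ => Finset.sum_congr rfl fun d _ =>
      Finset.sum_congr rfl fun e _ => ?_
    ring
  have hr : (omegaHat ω (cHat C hC2 φ)).1 a b = (1 / 2) *
      (∑ c, ∑ d, ∑ e, C c d b e * ω a e * φ.1 c d
        - ∑ c, ∑ d, ∑ e, C c d a e * ω b e * φ.1 c d) := by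
    rw [← h₃ a b, ← h₃ b a, ← Finset.sum_sub_distrib]
    rfl
  have hw : ∑ c, ∑ d, weylAction C ω a c d b * φ.1 c d =
      ∑ c, ∑ d, ∑ e, C c d a e * ω b e * φ.1 c d
        - ∑ c, ∑ d, ∑ e, C c d b e * ω a e * φ.1 c d
        + ∑ c, ∑ d, ∑ e, C a b c e * ω d e * φ.1 c d
        - ∑ c, ∑ d, ∑ e, C a b d e * ω c e * φ.1 c d := by
    simp only [weylAction, ← Finset.sum_sub_distrib, ← Finset.sum_add_distrib, Finset.sum_mul,
      sub_mul, add_mul]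
  rw [hl, hr, hw, h₁, h₂]
  ring

/-- Let `n ≥ 2`, let `C` have Weyl symmetries, and let `ω` be a 2-form on
`ℝⁿ`. Then the Weyl compatibility condition (equation (weyl) of the paper) holds for `ω` if
and only if the endomorphisms `Ĉ` and `ω̂` of the space of 2-forms commute. -/
theorem weyl_compatibility_iff_commute (n : ℕ) (hn : 2 ≤ n)
    (C : Fin n → Fin n → Fin n → Fin n → ℝ)
    (hC1 : ∀ a b c d, C a b c d = -C b a c d)
    (hC2 : ∀ a b c d, C a b c d = -C a b d c)
    (hC3 : ∀ a b c d, C a b c d = C c d a b)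
    (hBianchi : ∀ a b c d, C a b c d + C a c d b + C a d b c = 0)
    (hTraceFree : ∀ b d, ∑ a, C a b a d = 0)
    (ω : Matrix (Fin n) (Fin n) ℝ) (hω_skew : ωᵀ = -ω) :
    (∀ a b c d, (1 / 2 : ℝ) * ∑ e,
        (C b c a e * ω d e - C b c d e * ω a e + C a d b e * ω c e - C a d c e * ω b e) = 0)
      ↔ (cHat C hC2) ∘ₗ (omegaHat ω) = (omegaHat ω) ∘ₗ (cHat C hC2) := by
  change (∀ a b c d, (1 / 2 : ℝ) * weylAction C ω a b c d = 0) ↔ _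
  constructor
  · intro h
    have hw (a b c d) : weylAction C ω a b c d = 0 := by linarith [h a b c d]
    refine LinearMap.ext fun φ => Subtype.ext (Matrix.ext fun a b => sub_eq_zero.1 ?_)
    refine (commutator_apply hC2 hC3 hω_skew φ a b).trans ?_
    simp [hw]
  · intro h a p q b
    let φ : twoForms n := ⟨single p q 1 - single q p 1, by
      rw [mem_twoForms, transpose_sub, transpose_single, transpose_single, neg_sub]⟩
    have hφ : (cHat C hC2 (omegaHat ω φ)).1 a b = (omegaHat ω (cHat C hC2 φ)).1 a b :=
      congrArg (fun ψ : twoForms n => ψ.1 a b) (LinearMap.congr_fun h φ)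
    have hc := commutator_apply hC2 hC3 hω_skew φ a b
    have hsum : ∑ c, ∑ d, weylAction C ω a c d b * φ.1 c d =
        weylAction C ω a p q b - weylAction C ω a q p b := by
      simp [φ, single_apply, mul_sub, ite_and]
    rw [hφ, sub_self, hsum, weylAction_swap hC1 ω a p q b] at hc
    linarith

end
end

section
/- Let V be a real inner product space of finite dimension n, let ω : V →ₗ[ℝ] V be skew-adjoint with ω ∘ ω = −σ² • id for some real σ > 0, let Υ ∈ V, set K := ω Υ, and let μ be the 3-form μ(x,y,z) := ⟨Υ,x⟩·ω♭(y,z) + ⟨Υ,y⟩·ω♭(z,x) + ⟨Υ,z⟩·ω♭(x,y), where ω♭(x,y) := ⟨x, ω y⟩. Then μ(x, y, K) = 0 for all x, y ∈ V. -/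
open scoped RealInnerProductSpace

/-- Let `V` be a real inner product space of finite dimension `n`, let
`ω : V →ₗ[ℝ] V` be skew-adjoint with `ω ∘ ω = −σ² • id` for some real `σ > 0`, let `Υ ∈ V`,
set `K := ω Υ`, and let `μ` be the 3-form
`μ(x,y,z) = ⟨Υ,x⟩·ω♭(y,z) + ⟨Υ,y⟩·ω♭(z,x) + ⟨Υ,z⟩·ω♭(x,y)` where `ω♭(x,y) = ⟨x, ω y⟩`.
Then `μ(x, y, K) = 0` for all `x, y ∈ V`. -/
theorem mu_contract_K_eq_zero
    {V : Type*} [NormedAddCommGroup V] [InnerProductSpace ℝ V] [FiniteDimensional ℝ V]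
    (n : ℕ) (hdim : Module.finrank ℝ V = n)
    (ω : V →ₗ[ℝ] V)
    (hskew : ∀ x y : V, ⟪ω x, y⟫ = -⟪x, ω y⟫)
    (σ : ℝ) (hσ : 0 < σ)
    (hsq : ω ∘ₗ ω = (-(σ ^ 2)) • (LinearMap.id : V →ₗ[ℝ] V))
    (Υ : V) (K : V) (hK : K = ω Υ)
    (μ : V → V → V → ℝ)
    (hμ : ∀ x y z : V, μ x y z = ⟪Υ, x⟫ * ⟪y, ω z⟫ + ⟪Υ, y⟫ * ⟪z, ω x⟫ + ⟪Υ, z⟫ * ⟪x, ω y⟫) :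
    ∀ x y : V, μ x y K = 0 := by
  intro x y
  have hω (v : V) : ω (ω v) = (-(σ ^ 2)) • v := by
    simpa using LinearMap.congr_fun hsq v
  have hself : ⟪Υ, ω Υ⟫ = 0 := by
    have h := hskew Υ Υ
    rw [real_inner_comm] at h
    linarith
  rw [hμ, hK, hω, hself, hskew Υ (ω x), hω, real_inner_smul_right, real_inner_smul_right,
    real_inner_comm Υ y]
  ring
end

section
/- Let V be a real inner product space of finite dimension n, let ω : V →ₗ[ℝ] V be skew-adjoint with ω ∘ ω = −σ² • id for some real σ > 0, let Υ ∈ V, and let μ be the 3-form μ(x,y,z) := ⟨Υ,x⟩·ω♭(y,z) + ⟨Υ,y⟩·ω♭(z,x) + ⟨Υ,z⟩·ω♭(x,y), where ω♭(x,y) := ⟨x, ω y⟩. Then for every orthonormal basis (e_i) of V and every x ∈ V: ∑_{i,j} ω♭(e_i, e_j) · μ(x, e_i, e_j) = (n−2)·σ²·⟨Υ, x⟩. -/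
open scoped RealInnerProductSpace

/-- Let `V` be a real inner product space of finite dimension `n`, let
`ω : V →ₗ[ℝ] V` be skew-adjoint with `ω ∘ ω = −σ² • id` for some real `σ > 0`, let `Υ ∈ V`,
and let `μ(x,y,z) = ⟨Υ,x⟩·ω♭(y,z) + ⟨Υ,y⟩·ω♭(z,x) + ⟨Υ,z⟩·ω♭(x,y)` where
`ω♭(x,y) = ⟨x, ω y⟩`. Then for every orthonormal basis `(e_i)` of `V` and every `x ∈ V`:
`∑_{i,j} ω♭(e_i, e_j) · μ(x, e_i, e_j) = (n−2)·σ²·⟨Υ, x⟩`. -/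
theorem mu_omega_contraction
    {V : Type*} [NormedAddCommGroup V] [InnerProductSpace ℝ V] [FiniteDimensional ℝ V]
    (n : ℕ) (hdim : Module.finrank ℝ V = n)
    (ω : V →ₗ[ℝ] V)
    (hskew : ∀ x y : V, ⟪ω x, y⟫ = -⟪x, ω y⟫)
    (σ : ℝ) (hσ : 0 < σ)
    (hsq : ω ∘ₗ ω = (-(σ ^ 2)) • (LinearMap.id : V →ₗ[ℝ] V))
    (Υ : V)
    (μ : V → V → V → ℝ)
    (hμ : ∀ x y z : V, μ x y z = ⟪Υ, x⟫ * ⟪y, ω z⟫ + ⟪Υ, y⟫ * ⟪z, ω x⟫ + ⟪Υ, z⟫ * ⟪x, ω y⟫)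
    (e : OrthonormalBasis (Fin n) ℝ V) (x : V) :
    ∑ i, ∑ j, ⟪e i, ω (e j)⟫ * μ x (e i) (e j) = ((n : ℝ) - 2) * σ ^ 2 * ⟪Υ, x⟫ := by
  have hωω (y z : V) : ⟪ω y, ω z⟫ = σ ^ 2 * ⟪y, z⟫ := by
    have h : ω (ω z) = (-(σ ^ 2)) • z := by simpa using LinearMap.congr_fun hsq z
    rw [hskew, h, real_inner_smul_right]
    ring
  have hinner (j : Fin n) : ∑ i, ⟪e i, ω (e j)⟫ * μ x (e i) (e j) =
      ⟪Υ, x⟫ * σ ^ 2 - ⟪ω Υ, e j⟫ * ⟪e j, ω x⟫ - σ ^ 2 * (⟪Υ, e j⟫ * ⟪e j, x⟫) := by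
    calc
      _ = ∑ i, (⟪Υ, x⟫ * (⟪ω (e j), e i⟫ * ⟪e i, ω (e j)⟫) +
            ⟪e j, ω x⟫ * (⟪Υ, e i⟫ * ⟪e i, ω (e j)⟫) -
            ⟪Υ, e j⟫ * (⟪ω x, e i⟫ * ⟪e i, ω (e j)⟫)) := by
        refine Finset.sum_congr rfl fun i _ => ?_
        rw [hμ, real_inner_comm (e i) (ω (e j)), hskew x (e i)]
        ring
      _ = ⟪Υ, x⟫ * ⟪ω (e j), ω (e j)⟫ + ⟪e j, ω x⟫ * ⟪Υ, ω (e j)⟫ -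
            ⟪Υ, e j⟫ * ⟪ω x, ω (e j)⟫ := by
        simp only [Finset.sum_sub_distrib, Finset.sum_add_distrib, ← Finset.mul_sum,
          e.sum_inner_mul_inner]
      _ = _ := by
        rw [hωω, hωω, hskew Υ, real_inner_self_eq_norm_sq, e.norm_eq_one,
          real_inner_comm (e j) x]
        ring
  rw [Finset.sum_comm]
  simp only [hinner, Finset.sum_sub_distrib, ← Finset.mul_sum, e.sum_inner_mul_inner, hωω,
    Finset.sum_const, Finset.card_univ, Fintype.card_fin, nsmul_eq_mul]
  ring
end

section
/- Let V be a real inner product space of finite dimension n, let ω : V →ₗ[ℝ] V be skew-adjoint with ω ∘ ω = −σ² • id for some real σ > 0, let Υ ∈ V, set K := ω Υ, and let μ be the 3-form μ(x,y,z) := ⟨Υ,x⟩·ω♭(y,z) + ⟨Υ,y⟩·ω♭(z,x) + ⟨Υ,z⟩·ω♭(x,y), where ω♭(x,y) := ⟨x, ω y⟩. Then for every orthonormal basis (e_i) of V and all x, y ∈ V: ∑_{i,j} μ(x, e_i, e_j) · μ(y, e_i, e_j) = 2·‖K‖²·⟨x, y⟩ − 2·⟨K, x⟩·⟨K, y⟩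 + (n−4)·σ²·⟨Υ, x⟩·⟨Υ, y⟩. -/
open scoped RealInnerProductSpace

/-- Parseval's identity, with both basis vectors on the right. -/
theorem OrthonormalBasis.sum_inner_mul_inner_right {ι V : Type*} [Fintype ι]
    [NormedAddCommGroup V] [InnerProductSpace ℝ V] (e : OrthonormalBasis ι ℝ V) (x y : V) :
    ∑ i, ⟪x, e i⟫ * ⟪y, e i⟫ = ⟪x, y⟫ := by
  simpa only [real_inner_comm] using e.sum_inner_mul_inner x y

/-- Let `V` be a real inner product space of finite dimension `n`, let
`ω : V →ₗ[ℝ] V` be skew-adjoint with `ω ∘ ω = −σ² • id` for some real `σ > 0`, let `Υ ∈ V`,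
set `K := ω Υ`, and let `μ(x,y,z) = ⟨Υ,x⟩·ω♭(y,z) + ⟨Υ,y⟩·ω♭(z,x) + ⟨Υ,z⟩·ω♭(x,y)` where
`ω♭(x,y) = ⟨x, ω y⟩`. Then for every orthonormal basis `(e_i)` of `V` and all `x, y ∈ V`:
`∑_{i,j} μ(x,e_i,e_j)·μ(y,e_i,e_j) = 2‖K‖²⟨x,y⟩ − 2⟨K,x⟩⟨K,y⟩ + (n−4)σ²⟨Υ,x⟩⟨Υ,y⟩`. -/
theorem mu_mu_contraction
    {V : Type*} [NormedAddCommGroup V] [InnerProductSpace ℝ V] [FiniteDimensional ℝ V]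
    (n : ℕ) (hdim : Module.finrank ℝ V = n)
    (ω : V →ₗ[ℝ] V)
    (hskew : ∀ x y : V, ⟪ω x, y⟫ = -⟪x, ω y⟫)
    (σ : ℝ) (hσ : 0 < σ)
    (hsq : ω ∘ₗ ω = (-(σ ^ 2)) • (LinearMap.id : V →ₗ[ℝ] V))
    (Υ : V) (K : V) (hK : K = ω Υ)
    (μ : V → V → V → ℝ)
    (hμ : ∀ x y z : V, μ x y z = ⟪Υ, x⟫ * ⟪y, ω z⟫ + ⟪Υ, y⟫ * ⟪z, ω x⟫ + ⟪Υ, z⟫ * ⟪x, ω y⟫)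
    (e : OrthonormalBasis (Fin n) ℝ V) (x y : V) :
    ∑ i, ∑ j, μ x (e i) (e j) * μ y (e i) (e j) =
      2 * ‖K‖ ^ 2 * ⟪x, y⟫ - 2 * ⟪K, x⟫ * ⟪K, y⟫
        + ((n : ℝ) - 4) * σ ^ 2 * ⟪Υ, x⟫ * ⟪Υ, y⟫ := by
  have hinner : ∀ v w : V, ⟪ω v, ω w⟫ = σ ^ 2 * ⟪v, w⟫ := fun v w ↦ by
    have hw : ω (ω w) = (-(σ ^ 2)) • w := LinearMap.congr_fun hsq w
    rw [hskew, hw, real_inner_smul_right]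
    ring
  have hμ_riesz : ∀ v w z : V, μ v w z = ⟪-⟪Υ, v⟫ • ω w + ⟪Υ, w⟫ • ω v - ⟪ω v, w⟫ • Υ, z⟫ :=
    fun v w z ↦ by
      simp only [hμ, inner_sub_left, inner_add_left, real_inner_smul_left]
      rw [real_inner_comm (ω v) z, hskew w z, hskew v w]
      ring
  have hK_left : ∀ v : V, ⟪Υ, ω v⟫ = -⟪K, v⟫ := fun v ↦ by rw [hK, hskew, neg_neg]
  have hK_right : ∀ v : V, ⟪ω v, Υ⟫ = -⟪K, v⟫ := fun v ↦ by rw [real_inner_comm, hK_left]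
  have hrow : ∀ w : V, ∑ j, μ x w (e j) * μ y w (e j) =
      ⟪Υ, x⟫ * ⟪Υ, y⟫ * σ ^ 2 * ⟪w, w⟫
        - ⟪Υ, x⟫ * σ ^ 2 * (⟪Υ, w⟫ * ⟪y, w⟫) - ⟪Υ, y⟫ * σ ^ 2 * (⟪Υ, w⟫ * ⟪x, w⟫)
        - ⟪Υ, x⟫ * (⟪ω y, w⟫ * ⟪K, w⟫) - ⟪Υ, y⟫ * (⟪ω x, w⟫ * ⟪K, w⟫)
        + σ ^ 2 * ⟪x, y⟫ * (⟪Υ, w⟫ * ⟪Υ, w⟫) + ⟪Υ, Υ⟫ * (⟪ω x, w⟫ * ⟪ω y, w⟫)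
        + ⟪K, y⟫ * (⟪Υ, w⟫ * ⟪ω x, w⟫) + ⟪K, x⟫ * (⟪Υ, w⟫ * ⟪ω y, w⟫) := fun w ↦ by
    simp only [hμ_riesz]
    rw [e.sum_inner_mul_inner_right]
    simp only [inner_sub_left, inner_add_left, inner_sub_right, inner_add_right,
      real_inner_smul_left, real_inner_smul_right, hinner, hK_left, hK_right]
    rw [real_inner_comm y w]
    ring
  have hnorm : ‖K‖ ^ 2 = σ ^ 2 * ⟪Υ, Υ⟫ := by rw [← real_inner_self_eq_norm_sq, hK, hinner]
  have hωK : ∀ v : V, ⟪ω v, K⟫ = σ ^ 2 * ⟪Υ, v⟫ := fun v ↦ by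
    rw [hK, hinner, real_inner_comm]
  have hone : ∑ i, ⟪e i, e i⟫ = (n : ℝ) := by simp
  simp only [hrow, Finset.sum_add_distrib, Finset.sum_sub_distrib, ← Finset.mul_sum,
    e.sum_inner_mul_inner_right, hone, hinner, hωK, hK_left, hnorm]
  ring
end

section
/- Let V be a real inner product space of finite dimension n, let ω : V →ₗ[ℝ] V be a skew-adjoint endomorphism, and let τ be an alternating trilinear form on V. Suppose that for all x, y, z ∈ V: τ(y, z, ω x) + τ(x, z, ω y) = 0. Then for every orthonormal basis (e_i) of V and every z ∈ V: ∑_i τ(ω e_i, e_i, z) = 0. -/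
open scoped RealInnerProductSpace

/-- An alternating trilinear form is invariant under cyclic permutation of its arguments. -/
theorem AlternatingMap.map_vec3_rotate {R M N : Type*} [CommRing R] [AddCommGroup M] [Module R M]
    [AddCommGroup N] [Module R N] (f : M [⋀^Fin 3]→ₗ[R] N) (a b c : M) :
    f ![b, c, a] = f ![a, b, c] := by
  have h := f.map_perm ![a, b, c] (finRotate 3)
  have hv : (![a, b, c] ∘ finRotate 3 : Fin 3 → M) = ![b, c, a] := by
    funext i
    fin_cases i <;> rfl
  rw [hv, sign_finRotate] at h
  simpa using h

/-- Let `V` be a real inner product space of finite dimension `n`, let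
`ω : V →ₗ[ℝ] V` be skew-adjoint, and let `τ` be an alternating trilinear form on `V` such that
`τ(y, z, ω x) + τ(x, z, ω y) = 0` for all `x, y, z`. Then for every orthonormal basis `(e_i)`
of `V` and every `z ∈ V`: `∑_i τ(ω e_i, e_i, z) = 0`. -/
theorem ker_T_omega_tracefree
    {V : Type*} [NormedAddCommGroup V] [InnerProductSpace ℝ V] [FiniteDimensional ℝ V]
    (n : ℕ) (hdim : Module.finrank ℝ V = n)
    (ω : V →ₗ[ℝ] V)
    (hskew : ∀ x y : V, ⟪ω x, y⟫ = -⟪x, ω y⟫)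
    (τ : V [⋀^Fin 3]→ₗ[ℝ] ℝ)
    (hτ : ∀ x y z : V, τ ![y, z, ω x] + τ ![x, z, ω y] = 0)
    (e : OrthonormalBasis (Fin n) ℝ V) (z : V) :
    ∑ i, τ ![ω (e i), e i, z] = 0 := by
  refine Finset.sum_eq_zero fun i _ => ?_
  have h := hτ (e i) (e i) z
  rw [AlternatingMap.map_vec3_rotate] at h
  linarith
end

section
/- Let V be a real inner product space of finite dimension n, let ω : V →ₗ[ℝ] V be skew-adjoint with ω ∘ ω = −σ² • id for some real σ > 0, and let K ∈ V be of the form K = ω Υ for some Υ ∈ V. Define the bilinear form Σ(x,y) := −(‖K‖²/(2σ²))·ω♭(x,y) + ⟨K,x⟩·⟨Υ,y⟩ − ⟨Υ,x⟩·⟨K,y⟩, where ω♭(x,y) := ⟨x, ω y⟩. Then Σ is ω-invariant: Σ(ω x, ω y) = σ²·Σ(x, y) for all x, y ∈ V; equivalently, with J := (1/σ)•ω, Σ(J x, J y) = Σ(x, y). -/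
open scoped RealInnerProductSpace

/-- Let `V` be a real inner product space of finite dimension `n`, let
`ω : V →ₗ[ℝ] V` be skew-adjoint with `ω ∘ ω = −σ² • id` for some real `σ > 0`, and let
`K = ω Υ` for some `Υ ∈ V`. Define
`Σ(x,y) = −(‖K‖²/(2σ²))·ω♭(x,y) + ⟨K,x⟩·⟨Υ,y⟩ − ⟨Υ,x⟩·⟨K,y⟩` where `ω♭(x,y) = ⟨x, ω y⟩`.
Then `Σ` is `ω`-invariant: `Σ(ω x, ω y) = σ²·Σ(x,y)` for all `x, y`; equivalently, with
`J := (1/σ) • ω`, `Σ(J x, J y) = Σ(x, y)`. -/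
theorem Sigma_is_hermitian
    {V : Type*} [NormedAddCommGroup V] [InnerProductSpace ℝ V] [FiniteDimensional ℝ V]
    (n : ℕ) (hdim : Module.finrank ℝ V = n)
    (ω : V →ₗ[ℝ] V)
    (hskew : ∀ x y : V, ⟪ω x, y⟫ = -⟪x, ω y⟫)
    (σ : ℝ) (hσ : 0 < σ)
    (hsq : ω ∘ₗ ω = (-(σ ^ 2)) • (LinearMap.id : V →ₗ[ℝ] V))
    (Υ : V) (K : V) (hK : K = ω Υ)
    (Sgm : V → V → ℝ)
    (hSgm : ∀ x y : V, Sgm x y = -(‖K‖ ^ 2 / (2 * σ ^ 2)) * ⟪x, ω y⟫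
      + ⟪K, x⟫ * ⟪Υ, y⟫ - ⟪Υ, x⟫ * ⟪K, y⟫) :
    (∀ x y : V, Sgm (ω x) (ω y) = σ ^ 2 * Sgm x y) ∧
    (∀ x y : V, Sgm (((1 / σ) • ω) x) (((1 / σ) • ω) y) = Sgm x y) := by
  have hωω (x : V) : ω (ω x) = (-(σ ^ 2)) • x := by
    simpa using LinearMap.congr_fun hsq x
  have hK_inner (x : V) : ⟪K, ω x⟫ = σ ^ 2 * ⟪Υ, x⟫ := by
    rw [hK, hskew, hωω, inner_smul_right]
    ring
  have hΥ_inner (x : V) : ⟪Υ, ω x⟫ = -⟪K, x⟫ := by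
    rw [hK, hskew, neg_neg]
  have hω_inner (x y : V) : ⟪ω x, ω (ω y)⟫ = σ ^ 2 * ⟪x, ω y⟫ := by
    rw [hωω, inner_smul_right, hskew]
    ring
  have hinv (x y : V) : Sgm (ω x) (ω y) = σ ^ 2 * Sgm x y := by
    simp only [hSgm, hK_inner, hΥ_inner, hω_inner]
    ring
  have hsmul (c : ℝ) (x y : V) : Sgm (c • x) (c • y) = c ^ 2 * Sgm x y := by
    simp only [hSgm, map_smul, real_inner_smul_left, real_inner_smul_right]
    ring
  refine ⟨hinv, fun x y => ?_⟩
  rw [LinearMap.smul_apply, LinearMap.smul_apply, hsmul, hinv]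
  field_simp
end

section
/- Let m ≥ 1 and let J ∈ M_{2m}(ℝ) be the block matrix J = fromBlocks 0 (I_m) (−I_m) 0. The set { A ∈ M_{2m}(ℝ) : Aᵀ = −A and A = J * A * J } is an ℝ-linear subspace of M_{2m}(ℝ) of dimension m(m−1). -/
open Matrix

/-- The submodule of skew-symmetric matrices. -/
def skewSymmetricMatrices (n R : Type*) [CommRing R] : Submodule R (Matrix n n R) where
  carrier := {A | Aᵀ = -A}
  zero_mem' := by simp
  add_mem' {A B} hA hB := by
    simp only [Set.mem_ofPred_eq] at hA hB ⊢
    rw [transpose_add, hA, hB, neg_add]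
  smul_mem' c A hA := by
    simp only [Set.mem_ofPred_eq] at hA ⊢
    rw [transpose_smul, hA, smul_neg]

lemma mem_skewSymmetricMatrices {n R : Type*} [CommRing R] {A : Matrix n n R} :
    A ∈ skewSymmetricMatrices n R ↔ Aᵀ = -A := Iff.rfl

/-- A real skew-symmetric matrix is determined by its entries above the diagonal, which may be
prescribed arbitrarily. -/
def skewSymmetricMatricesEquiv (n : Type*) [LinearOrder n] :
    skewSymmetricMatrices n ℝ ≃ₗ[ℝ] ((j : n) → Set.Iio j → ℝ) where
  toFun A j i := A.1 i j
  map_add' _ _ := rfl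
  map_smul' _ _ := rfl
  invFun f := ⟨of fun i j ↦
    if h : i < j then f j ⟨i, h⟩ else if h : j < i then -f i ⟨j, h⟩ else 0, by
      rw [mem_skewSymmetricMatrices]
      ext i j
      rcases lt_trichotomy i j with h | rfl | h
      · simp [h, h.not_gt]
      · simp
      · simp [h, h.not_gt]⟩
  left_inv A := by
    have hA (i j : n) : A.1 j i = -A.1 i j := congrFun (congrFun A.2 i) j
    ext i j
    rcases lt_trichotomy i j with h | rfl | h
    · simp [h]
    · have := hA i i
      simp only [of_apply, lt_self_iff_false, dite_false]
      linarith
    · simp [h, h.not_gt, hA j i]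
  right_inv f := by
    ext j ⟨i, hi⟩
    have hi' : i < j := hi
    simp [hi']

lemma finrank_skewSymmetricMatrices_mul_two (m : ℕ) :
    Module.finrank ℝ (skewSymmetricMatrices (Fin m) ℝ) * 2 = m * (m - 1) := by
  rw [(skewSymmetricMatricesEquiv (Fin m)).finrank_eq, Module.finrank_pi_fintype]
  simp only [Module.finrank_fintype_fun_eq_card, Fintype.card_Iio, Fin.card_Iio]
  rw [Fin.sum_univ_eq_sum_range (fun i ↦ i), Finset.sum_range_id_mul_two]

/-- The product of two submodules, as a submodule, is equivalent to their product as modules. -/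
def submoduleProdEquiv {R M N : Type*} [Semiring R] [AddCommMonoid M] [AddCommMonoid N]
    [Module R M] [Module R N] (p : Submodule R M) (q : Submodule R N) :
    p.prod q ≃ₗ[R] p × q where
  toFun x := (⟨x.1.1, x.2.1⟩, ⟨x.1.2, x.2.2⟩)
  invFun x := ⟨(x.1.1, x.2.1), x.1.2, x.2.2⟩
  map_add' _ _ := rfl
  map_smul' _ _ := rfl
  left_inv _ := rfl
  right_inv _ := rfl

/-- The block matrix `fromBlocks a b b (-a)` as a linear function of the pair `(a, b)`. -/
def fromBlocksSymmNeg (n R : Type*) [CommRing R] :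
    Matrix n n R × Matrix n n R →ₗ[R] Matrix (n ⊕ n) (n ⊕ n) R where
  toFun p := fromBlocks p.1 p.2 p.2 (-p.1)
  map_add' p q := by simp [fromBlocks_add, add_comm]
  map_smul' c p := by simp [fromBlocks_smul]

lemma fromBlocksSymmNeg_injective (n R : Type*) [CommRing R] :
    Function.Injective (fromBlocksSymmNeg n R) := fun p q h ↦ by
  obtain ⟨h₁, h₂, -, -⟩ := fromBlocks_inj.mp h
  exact Prod.ext h₁ h₂

/-- Let `m ≥ 1` and let `J` be the standard complex structure block matrix
`J = fromBlocks 0 1 (-1) 0` on `ℝ^{2m}`. The set of `2m×2m` real matrices `A` with `Aᵀ = −A`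
and `A = J * A * J` is an `ℝ`-linear subspace of the space of `2m×2m` matrices, of dimension
`m(m−1)`. -/
theorem skew_JAJ_subspace_dim (m : ℕ) (hm : 1 ≤ m)
    (J : Matrix (Fin m ⊕ Fin m) (Fin m ⊕ Fin m) ℝ)
    (hJ : J = Matrix.fromBlocks 0 1 (-1) 0) :
    ∃ S : Submodule ℝ (Matrix (Fin m ⊕ Fin m) (Fin m ⊕ Fin m) ℝ),
      (S : Set (Matrix (Fin m ⊕ Fin m) (Fin m ⊕ Fin m) ℝ))
          = {A | Aᵀ = -A ∧ A = J * A * J} ∧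
      Module.finrank ℝ S = m * (m - 1) := by
  subst hJ
  let T := skewSymmetricMatrices (Fin m) ℝ
  refine ⟨(T.prod T).map (fromBlocksSymmNeg (Fin m) ℝ), ?_, ?_⟩
  · ext A
    rw [← fromBlocks_toBlocks A]
    generalize A.toBlocks₁₁ = a, A.toBlocks₁₂ = b, A.toBlocks₂₁ = c, A.toBlocks₂₂ = d
    simp only [SetLike.mem_coe, Submodule.mem_map, Submodule.mem_prod, Prod.exists,
      Set.mem_ofPred_eq, fromBlocksSymmNeg, LinearMap.coe_mk, AddHom.coe_mk, fromBlocks_transpose,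
      fromBlocks_neg, fromBlocks_multiply, fromBlocks_inj, T, mem_skewSymmetricMatrices]
    simp only [zero_mul, one_mul, mul_one, mul_zero, neg_mul, mul_neg, zero_add, add_zero, neg_neg]
    constructor
    · rintro ⟨a', b', ⟨ha, hb⟩, rfl, rfl, rfl, rfl⟩
      simp [ha, hb]
    · rintro ⟨⟨ha, -, hb, -⟩, -, rfl, -, rfl⟩
      exact ⟨a, b, ⟨ha, hb⟩, rfl, rfl, rfl, rfl⟩
  · rw [← (Submodule.equivMapOfInjective _ (fromBlocksSymmNeg_injective _ ℝ) _).finrank_eq,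
      (submoduleProdEquiv T T).finrank_eq, Module.finrank_prod, ← mul_two,
      finrank_skewSymmetricMatrices_mul_two]
end
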